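/- Let d ≥ 1, let X ⊆ ℝ^d be nonempty, closed and convex, and let f : ℝ^d → ℝ be differentiable with ‖∇f(x) − ∇f(y)‖ ≤ L‖x − y‖ for all x, y ∈ ℝ^d (L > 0). Let η, ε̂ > 0 and let x^k, x^{k+1} ∈ X and ξ^{k+1}, Γ^{k+1}, G^k ∈ ℝ^d satisfy ⟨x^{k+1} − x^k + η G^k + ξ^{k+1} + Γ^{k+1}, x − x^{k+1}⟩ ≥ 0 for all x ∈ X, and ‖Γ^{k+1}‖ ≤ ε̂. Define S := {v ∈ ℝ^d : ⟨v − ∇f(x^{k+1}), x − x^{k+1}⟩ ≤ 0 for all x ∈ X}. Then inf{‖v‖∞ : v ∈ S} ≤ (L + 1/η) ‖x^{k+1} − x^k‖ + ‖∇f(x^k) − G^k‖∞ + (1/η) ‖ξ^{k+1}‖∞ + ε̂/η. -/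

import Mathlib

open MeasureTheory ProbabilityTheory Finset
open scoped BigOperators

local notation "⟪" x ", " y "⟫" => @inner ℝ _ _ x y

noncomputable def norm1 {d : ℕ} (x : EuclideanSpace ℝ (Fin d)) : ℝ := ∑ i, |x i|

noncomputable def normInf {d : ℕ} (x : EuclideanSpace ℝ (Fin d)) : ℝ := ⨆ i, |x i|

lemma abs_apply_le_normInf {d : ℕ} (x : EuclideanSpace ℝ (Fin d)) (i : Fin d) :
    |x i| ≤ normInf x :=
  le_ciSup (f := fun j => |x j|) (Set.finite_range _).bddAbove i

lemma normInf_nonneg {d : ℕ} (x : EuclideanSpace ℝ (Fin d)) : 0 ≤ normInf x :=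
  Real.iSup_nonneg fun _ => abs_nonneg _

lemma abs_apply_le_norm {d : ℕ} (x : EuclideanSpace ℝ (Fin d)) (i : Fin d) : |x i| ≤ ‖x‖ := by
  simpa using PiLp.norm_apply_le x i

theorem stmt_9 {d : ℕ} (hd : 1 ≤ d)
    (X : Set (EuclideanSpace ℝ (Fin d)))
    (hXne : X.Nonempty) (hXcl : IsClosed X) (hXcv : Convex ℝ X)
    (f : EuclideanSpace ℝ (Fin d) → ℝ) (hf : Differentiable ℝ f)
    (L : ℝ) (hL : 0 < L)
    (hLip : ∀ a b : EuclideanSpace ℝ (Fin d), ‖gradient f a - gradient f b‖ ≤ L * ‖a - b‖)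
    (η ε : ℝ) (hη : 0 < η) (hε : 0 < ε)
    (xk xk1 : EuclideanSpace ℝ (Fin d)) (hxk : xk ∈ X) (hxk1 : xk1 ∈ X)
    (ξ Γ G : EuclideanSpace ℝ (Fin d))
    (hvi : ∀ z ∈ X, ⟪xk1 - xk + η • G + ξ + Γ, z - xk1⟫ ≥ 0)
    (hΓ : ‖Γ‖ ≤ ε) :
    sInf {c : ℝ | ∃ v : EuclideanSpace ℝ (Fin d),
        (∀ z ∈ X, ⟪v - gradient f xk1, z - xk1⟫ ≤ 0) ∧ c = normInf v}
      ≤ (L + 1 / η) * ‖xk1 - xk‖ + normInf (gradient f xk - G)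
        + (1 / η) * normInf ξ + ε / η := by
  have hη' : 0 < 1 / η := by positivity
  set w := xk1 - xk + η • G + ξ + Γ with hw
  have hle : normInf (gradient f xk1 - (1 / η) • w) ≤ (L + 1 / η) * ‖xk1 - xk‖
      + normInf (gradient f xk - G) + (1 / η) * normInf ξ + ε / η := by
    have : Nonempty (Fin d) := ⟨⟨0, hd⟩⟩
    refine ciSup_le fun i => ?_
    have hsplit : (gradient f xk1 - (1 / η) • w) i
        = (gradient f xk1 - gradient f xk) i + (gradient f xk - G) i
          - (1 / η) * (xk1 - xk) i - (1 / η) * ξ i - (1 / η) * Γ i := by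
      simp only [hw, PiLp.sub_apply, PiLp.add_apply, PiLp.smul_apply, smul_eq_mul]
      field_simp
      ring
    have hgrad := (abs_apply_le_norm (gradient f xk1 - gradient f xk) i).trans (hLip xk1 xk)
    have herr := abs_apply_le_normInf (gradient f xk - G) i
    have hstep := mul_le_mul_of_nonneg_left (abs_apply_le_norm (xk1 - xk) i) hη'.le
    have hξ := mul_le_mul_of_nonneg_left (abs_apply_le_normInf ξ i) hη'.le
    have hΓi := mul_le_mul_of_nonneg_left ((abs_apply_le_norm Γ i).trans hΓ) hη'.le
    rw [← abs_of_pos hη', ← abs_mul, abs_of_pos hη'] at hstep hξ hΓi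
    have hdiv : ε / η = (1 / η) * ε := by ring
    rw [hsplit, hdiv, add_mul]
    rw [abs_le] at *
    constructor <;> linarith
  refine (csInf_le (a := normInf (gradient f xk1 - (1 / η) • w)) ?_ ?_).trans hle
  · refine ⟨0, ?_⟩
    rintro c ⟨v, -, rfl⟩
    exact normInf_nonneg v
  · refine ⟨_, fun z hz => ?_, rfl⟩
    rw [sub_sub_cancel_left, inner_neg_left, real_inner_smul_left]
    exact neg_nonpos.2 (mul_nonneg hη'.le (hvi z hz))
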